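/- Let n ≥ 2 be even and let B be a non-splitting Rota–Baxter operator on the dihedral group D_{2n}. Then there is C ∈ {B, B̃} such that: D_{2n} = ker(C)·Im(C) is an exact factorization; C̃ restricted to Im(C) is multiplicative, i.e. C̃(x·y) = C̃(x)·C̃(y) for all x, y ∈ Im(C); the image C̃(Im(C)) equals R := Im(B) ∩ Im(B̃); and R has cardinality 2 or 4 with x² = e for every x ∈ R. -/

import Mathlib

/-- A Rota–Baxter operator of weight 1 on a group. -/
def IsRotaBaxter {G : Type*} [Group G] (B : G → G) : Prop :=
  ∀ g h : G, B g * B h = B (g * B g * h * (B g)⁻¹)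

/-- A splitting Rota–Baxter operator: comes from an exact factorization G = HL. -/
def IsSplitting {G : Type*} [Group G] (B : G → G) : Prop :=
  ∃ H L : Subgroup G, H ⊓ L = ⊥ ∧ (∀ g : G, ∃ h ∈ H, ∃ l ∈ L, g = h * l) ∧
    (∀ h ∈ H, ∀ l ∈ L, B (h * l) = l⁻¹)

/-- The companion Rota–Baxter operator B̃(g) = g⁻¹ · B(g⁻¹). -/
def tilde {G : Type*} [Group G] (B : G → G) : G → G := fun g => g⁻¹ * B g⁻¹

namespace IsRotaBaxter

variable {G : Type*} [Group G] {B : G → G}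

theorem map_one (hB : IsRotaBaxter B) : B 1 = 1 := by
  simpa using hB 1 1

/-- The subgroup `{(B g, g * B g)}` of `G × G` attached to a Rota–Baxter operator. -/
def graph (hB : IsRotaBaxter B) : Subgroup (G × G) where
  carrier := {p | B (p.2 * p.1⁻¹) = p.1}
  one_mem' := by simp [hB.map_one]
  mul_mem' := by
    rintro ⟨a, b⟩ ⟨c, d⟩ (h₁ : B (b * a⁻¹) = a) (h₂ : B (d * c⁻¹) = c)
    have h := hB (b * a⁻¹) (d * c⁻¹)
    rw [h₁, h₂] at h
    change B (b * d * (a * c)⁻¹) = a * c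
    rw [show b * d * (a * c)⁻¹ = b * a⁻¹ * a * (d * c⁻¹) * a⁻¹ by group, h]
  inv_mem' := by
    rintro ⟨a, b⟩ (h₁ : B (b * a⁻¹) = a)
    have h := hB (b * a⁻¹) (b⁻¹ * a)
    rw [h₁] at h
    change B (b⁻¹ * a⁻¹⁻¹) = a⁻¹
    rw [inv_inv, eq_inv_iff_mul_eq_one, mul_eq_one_comm, h,
      show b * a⁻¹ * a * (b⁻¹ * a) * a⁻¹ = 1 by group, hB.map_one]

theorem mem_graph (hB : IsRotaBaxter B) {a b : G} : (a, b) ∈ hB.graph ↔ B (b * a⁻¹) = a :=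
  Iff.rfl

theorem mk_mem_graph (hB : IsRotaBaxter B) (g : G) : (B g, g * B g) ∈ hB.graph := by
  simp [mem_graph]

theorem eq_one_of_diag_mem (hB : IsRotaBaxter B) {x : G} (h : (x, x) ∈ hB.graph) : x = 1 := by
  rw [mem_graph, mul_inv_cancel, hB.map_one] at h
  exact h.symm

theorem one_mem_graph_iff (hB : IsRotaBaxter B) {k : G} : (1, k) ∈ hB.graph ↔ B k = 1 := by
  simp [mem_graph]

theorem mem_range_iff (hB : IsRotaBaxter B) {a : G} :
    a ∈ Set.range B ↔ ∃ b, (a, b) ∈ hB.graph := by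
  constructor
  · rintro ⟨g, rfl⟩
    exact ⟨_, hB.mk_mem_graph g⟩
  · rintro ⟨b, h⟩
    exact ⟨_, h⟩

theorem tilde_eq_iff (hB : IsRotaBaxter B) {x b : G} :
    tilde B x = b ↔ (x * b, b) ∈ hB.graph := by
  simp only [tilde, mem_graph, mul_inv_rev, mul_inv_cancel_left]
  rw [inv_mul_eq_iff_eq_mul]

theorem tilde_tilde (B : G → G) : tilde (tilde B) = B := by
  funext g
  simp [tilde]

theorem tilde_isRotaBaxter (hB : IsRotaBaxter B) : IsRotaBaxter (tilde B) := by
  intro g h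
  have hg := (hB.tilde_eq_iff (x := g)).1 rfl
  have hh := (hB.tilde_eq_iff (x := h)).1 rfl
  refine ((hB.tilde_eq_iff).2 ?_).symm
  convert hB.graph.mul_mem hg hh using 1
  simp only [Prod.mk_mul_mk]
  congr 1
  group

theorem mem_graph_tilde (hB : IsRotaBaxter B) {a b : G} :
    (a, b) ∈ hB.tilde_isRotaBaxter.graph ↔ (b, a) ∈ hB.graph := by
  rw [mem_graph, hB.tilde_eq_iff]
  simp

theorem mem_range_tilde_iff (hB : IsRotaBaxter B) {b : G} :
    b ∈ Set.range (tilde B) ↔ ∃ a, (a, b) ∈ hB.graph := by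
  simp only [hB.tilde_isRotaBaxter.mem_range_iff, hB.mem_graph_tilde]

/-- `Im B ∩ Im B̃` as a subgroup. -/
def rangeInf (hB : IsRotaBaxter B) : Subgroup G :=
  hB.graph.map (MonoidHom.fst G G) ⊓ hB.graph.map (MonoidHom.snd G G)

theorem coe_rangeInf (hB : IsRotaBaxter B) :
    (hB.rangeInf : Set G) = Set.range B ∩ Set.range (tilde B) := by
  ext x
  rw [Set.mem_inter_iff, hB.mem_range_iff, hB.mem_range_tilde_iff]
  simp [rangeInf]

theorem tilde_image_range (hB : IsRotaBaxter B) :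
    tilde B '' Set.range B = Set.range B ∩ Set.range (tilde B) := by
  ext x
  rw [Set.mem_inter_iff, hB.mem_range_tilde_iff]
  constructor
  · rintro ⟨y, hy, rfl⟩
    have h := (hB.tilde_eq_iff (x := y)).1 rfl
    refine ⟨?_, _, h⟩
    obtain ⟨c, hc⟩ := hB.mem_range_iff.1 hy
    refine hB.mem_range_iff.2 ⟨c⁻¹ * tilde B y, ?_⟩
    simpa using hB.graph.mul_mem (hB.graph.inv_mem hc) h
  · rintro ⟨hx, a, ha⟩
    obtain ⟨c, hc⟩ := hB.mem_range_iff.1 hx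
    refine ⟨a * x⁻¹, hB.mem_range_iff.2 ⟨x * c⁻¹, ?_⟩, hB.tilde_eq_iff.2 (by simpa using ha)⟩
    simpa using hB.graph.mul_mem ha (hB.graph.inv_mem hc)

theorem isSplitting_of_rangeInf_eq_bot (hB : IsRotaBaxter B) (h : hB.rangeInf = ⊥) :
    IsSplitting B := by
  have htriv : ∀ x, x ∈ Set.range B → x ∈ Set.range (tilde B) → x = 1 := fun x h₁ h₂ => by
    rw [← Subgroup.mem_bot, ← h, ← SetLike.mem_coe, hB.coe_rangeInf]
    exact ⟨h₁, h₂⟩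
  have hker : ∀ a b, (a, b) ∈ hB.graph → (1, b) ∈ hB.graph := by
    intro a b hab
    have ha : tilde B a = 1 := by
      have : tilde B a ∈ Set.range B ∩ Set.range (tilde B) := by
        rw [← hB.tilde_image_range]
        exact ⟨a, hB.mem_range_iff.2 ⟨b, hab⟩, rfl⟩
      exact htriv _ this.1 this.2
    have h1 := hB.tilde_eq_iff.1 ha
    simpa using hB.graph.mul_mem (hB.graph.inv_mem h1) hab
  refine ⟨hB.graph.comap (MonoidHom.inr G G), hB.graph.map (MonoidHom.fst G G), ?_, ?_, ?_⟩
  · rw [eq_bot_iff]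
    rintro x ⟨hx₁, ⟨a, b⟩, hx₂, rfl⟩
    exact htriv _ (hB.mem_range_iff.2 ⟨b, hx₂⟩) (hB.mem_range_tilde_iff.2 ⟨1, hx₁⟩)
  · intro g
    have hg := hB.mk_mem_graph g
    exact ⟨g * B g, hker _ _ hg, (B g)⁻¹, ⟨_, hB.graph.inv_mem hg, rfl⟩, by simp⟩
  · rintro k hk _ ⟨⟨l, b⟩, hl, rfl⟩
    have h1 : (l, 1) ∈ hB.graph := by
      simpa using hB.graph.mul_mem hl (hB.graph.inv_mem (hker _ _ hl))
    have h2 := hB.graph.mul_mem (hB.graph.inv_mem h1) (show (1, k) ∈ hB.graph from hk)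
    simpa [mem_graph] using h2

/-- In a finite group, `ker B` and `Im B` factor the group as soon as they meet trivially. -/
theorem exists_ker_mul_range [Finite G] (hB : IsRotaBaxter B)
    (h : ∀ g, B g = 1 → g ∈ Set.range B → g = 1) (g : G) :
    ∃ k, B k = 1 ∧ ∃ l ∈ Set.range B, g = k * l := by
  have hex : ∀ x, ∃ c, (B x, c) ∈ hB.graph := fun x => ⟨_, hB.mk_mem_graph x⟩
  have hsec : ∃ σ : G → G, ∀ x, (B x, σ (B x)) ∈ hB.graph := by
    classical
    refine ⟨fun a => if h : ∃ c, (a, c) ∈ hB.graph then h.choose else 1, fun x => ?_⟩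
    simp only [dif_pos (hex x)]
    exact (hex x).choose_spec
  obtain ⟨σ, hσ⟩ := hsec
  have hker : ∀ x, B (x * B x * (σ (B x))⁻¹) = 1 := fun x => by
    rw [← hB.one_mem_graph_iff]
    simpa using hB.graph.mul_mem (hB.mk_mem_graph x) (hB.graph.inv_mem (hσ x))
  have hinj : Function.Injective fun x => x * B x * (σ (B x))⁻¹ * (B x)⁻¹ := by
    intro x y hxy
    simp only at hxy
    have hk : (1, (y * B y * (σ (B y))⁻¹)⁻¹ * (x * B x * (σ (B x))⁻¹)) ∈ hB.graph := by
      simpa using hB.graph.mul_mem (hB.graph.inv_mem (hB.one_mem_graph_iff.2 (hker y)))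
        (hB.one_mem_graph_iff.2 (hker x))
    have heq : (y * B y * (σ (B y))⁻¹)⁻¹ * (x * B x * (σ (B x))⁻¹) = (B y)⁻¹ * B x := by
      rw [inv_mul_eq_iff_eq_mul, ← mul_assoc, ← hxy]
      group
    rw [heq] at hk
    have hBxy : (B y)⁻¹ * B x = 1 := h _ (hB.one_mem_graph_iff.1 hk) (hB.mem_range_iff.2
      ⟨_, hB.graph.mul_mem (hB.graph.inv_mem (hB.mk_mem_graph y)) (hB.mk_mem_graph x)⟩)
    rw [inv_mul_eq_one] at hBxy
    rw [hBxy] at hxy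
    simpa using hxy
  obtain ⟨x, rfl⟩ := Finite.surjective_of_injective hinj g
  exact ⟨_, hker x, (B x)⁻¹, hB.mem_range_iff.2 ⟨_, hB.graph.inv_mem (hB.mk_mem_graph x)⟩, rfl⟩

/-- If squares of elements of `Im B` lie in `ker B̃`, then `B̃` is multiplicative on `Im B`. -/
theorem tilde_mul_of_sq (hB : IsRotaBaxter B)
    (hsq : ∀ a b, (a, b) ∈ hB.graph → (a * a, 1) ∈ hB.graph)
    {x y : G} (hx : x ∈ Set.range B) (hy : y ∈ Set.range B) :
    tilde B (x * y) = tilde B x * tilde B y := by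
  have hp := (hB.tilde_eq_iff (x := x)).1 rfl
  have hq := (hB.tilde_eq_iff (x := y)).1 rfl
  obtain ⟨u, hu⟩ := hB.mem_range_iff.1 hx
  obtain ⟨v, hv⟩ := hB.mem_range_iff.1 hy
  set p := tilde B x
  set q := tilde B y
  have hp' := hB.graph.mul_mem (hB.graph.inv_mem hu) hp
  have h1 := hsq _ _ hv
  have h2 := hsq _ _ (hB.graph.mul_mem (hB.graph.inv_mem hv) hp')
  have h3 := hB.graph.inv_mem (hsq _ _ hp')
  have hc := hB.graph.mul_mem (hB.graph.mul_mem hu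
    (hB.graph.mul_mem (hB.graph.mul_mem h1 h2) h3)) (hB.graph.inv_mem hu)
  have := hB.graph.mul_mem hc (hB.graph.mul_mem hp hq)
  rw [hB.tilde_eq_iff]
  convert this using 1
  simp only [Prod.mk_mul_mk, Prod.inv_mk]
  congr 1 <;> group

end IsRotaBaxter

namespace DihedralGroup

variable {n : ℕ} {B : DihedralGroup n → DihedralGroup n}

theorem isRotaBaxter_sq_mem_graph_of_mixed (hB : IsRotaBaxter B) {i j : ZMod n}
    (h₀ : (r i, sr j) ∈ hB.graph) {a b : DihedralGroup n} (h : (a, b) ∈ hB.graph) :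
    (a * a, 1) ∈ hB.graph := by
  have hs : ∀ {c : DihedralGroup n} {k : ZMod n}, (c, sr k) ∈ hB.graph →
      (c * c, 1) ∈ hB.graph := fun hc => by
    have := hB.graph.mul_mem hc hc
    rwa [Prod.mk_mul_mk, sr_mul_self] at this
  rcases b with k | k
  · rcases a with l | l
    · have h1 := hs (show (r l * r i, sr (j - k)) ∈ hB.graph by
        simpa using hB.graph.mul_mem h h₀)
      have := hB.graph.mul_mem h1 (hB.graph.inv_mem (hs h₀))
      convert this using 1
      simp only [r_mul_r, Prod.inv_mk, inv_r, inv_one, Prod.mk_mul_mk, mul_one]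
      congr 2
      ring
    · rw [sr_mul_self]
      exact hB.graph.one_mem
  · exact hs h

/-- Squares of elements of `Im B` lie in `ker B̃`. -/
theorem isRotaBaxter_sq_mem_graph (hB : IsRotaBaxter B) {a b : DihedralGroup n}
    (h : (a, b) ∈ hB.graph) : (a * a, 1) ∈ hB.graph := by
  have h₀ := hB.mk_mem_graph (sr 0)
  rcases hBs : B (sr 0) with i | i
  · rw [hBs, sr_mul_r] at h₀
    exact isRotaBaxter_sq_mem_graph_of_mixed hB h₀ h
  · rw [hBs, sr_mul_sr] at h₀
    have := isRotaBaxter_sq_mem_graph_of_mixed hB.tilde_isRotaBaxter (hB.mem_graph_tilde.2 h₀)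
      (hB.mem_graph_tilde.2 h)
    have hb := hB.mem_graph_tilde.1 this
    simpa using hB.graph.mul_mem (hB.graph.mul_mem h h) (hB.graph.inv_mem hb)

theorem isRotaBaxter_sq_mem_graph' (hB : IsRotaBaxter B) {a b : DihedralGroup n}
    (h : (a, b) ∈ hB.graph) : (1, b * b) ∈ hB.graph :=
  hB.mem_graph_tilde.1 (isRotaBaxter_sq_mem_graph hB.tilde_isRotaBaxter (hB.mem_graph_tilde.2 h))

theorem isRotaBaxter_mul_self_of_mem_rangeInf (hB : IsRotaBaxter B) {x : DihedralGroup n}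
    (hx : x ∈ hB.rangeInf) : x * x = 1 := by
  obtain ⟨⟨⟨a, b⟩, hab, rfl⟩, ⟨c, d⟩, hcd, h⟩ := hx
  change d = a at h
  subst h
  have h1 := isRotaBaxter_sq_mem_graph hB hab
  have h2 := isRotaBaxter_sq_mem_graph' hB hcd
  exact hB.eq_one_of_diag_mem (by simpa using hB.graph.mul_mem h1 h2)

theorem eq_of_add_self_eq_zero [NeZero n] {i j : ZMod n} (hi : i + i = 0) (hj : j + j = 0)
    (hi0 : i ≠ 0) (hj0 : j ≠ 0) : i = j := by
  have key : ∀ {k : ZMod n}, k + k = 0 → k ≠ 0 → 2 * k.val = n := by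
    intro k hk hk0
    have h1 : n ∣ 2 * k.val := by
      rw [← ZMod.natCast_eq_zero_iff]
      push_cast
      rw [ZMod.natCast_zmod_val, two_mul, hk]
    have h2 := ZMod.val_lt k
    have h3 : k.val ≠ 0 := by simpa using hk0
    obtain ⟨c, hc⟩ := h1
    have : c = 1 := by
      have : c < 2 := by nlinarith
      have : c ≠ 0 := by rintro rfl; omega
      omega
    subst this
    omega
  apply ZMod.val_injective n
  have := key hi hi0
  have := key hj hj0
  omega

theorem ncard_of_mul_self [NeZero n] (S : Subgroup (DihedralGroup n)) (hS : S ≠ ⊥)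
    (h2 : ∀ x ∈ S, x * x = 1) :
    (S : Set (DihedralGroup n)).ncard = 2 ∨ (S : Set (DihedralGroup n)).ncard = 4 := by
  have hrr : ∀ {i}, r i ∈ S → i + i = 0 := fun {i} hi => by
    have := h2 _ hi
    rw [r_mul_r, one_def] at this
    injection this
  have huniq : ∀ {i j}, r i ∈ S → r j ∈ S → i ≠ 0 → j ≠ 0 → i = j := fun hi hj =>
    eq_of_add_self_eq_zero (hrr hi) (hrr hj)
  have hss : ∀ {i j}, sr i ∈ S → sr j ∈ S → r (j - i) ∈ S := fun hi hj => by
    simpa using S.mul_mem hi hj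
  have h1 : (r 0 : DihedralGroup n) ∈ S := S.one_mem
  by_cases hz : ∃ i, i ≠ 0 ∧ r i ∈ S
  · obtain ⟨i, hi0, hi⟩ := hz
    by_cases hs : ∃ j, sr j ∈ S
    · right
      obtain ⟨j, hj⟩ := hs
      have hji : sr (j + i) ∈ S := by simpa using S.mul_mem hj hi
      have : (S : Set (DihedralGroup n)) = ({r 0, r i, sr j, sr (j + i)} : Finset _) := by
        ext x
        simp only [SetLike.mem_coe, Finset.coe_insert, Finset.coe_singleton,
          Set.mem_insert_iff, Set.mem_singleton_iff]
        refine ⟨fun hx => ?_, by rintro (rfl | rfl | rfl | rfl) <;> assumption⟩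
        rcases x with k | k
        · by_cases hk : k = 0
          · simp [hk]
          · simp [huniq hx hi hk hi0]
        · by_cases hk : k - j = 0
          · simp [sub_eq_zero.1 hk]
          · have := huniq (hss hj hx) hi hk hi0
            simp [← this]
      rw [this, Set.ncard_coe_finset]
      simp [Finset.card_insert_of_notMem, -r_zero, hi0, hi0.symm]
    · left
      push Not at hs
      rw [show (S : Set (DihedralGroup n)) = {r 0, r i} from ?_, Set.ncard_pair]
      · simpa [-r_zero] using hi0.symm
      · ext x
        simp only [SetLike.mem_coe, Set.mem_insert_iff, Set.mem_singleton_iff]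
        refine ⟨fun hx => ?_, by rintro (rfl | rfl) <;> assumption⟩
        rcases x with k | k
        · by_cases hk : k = 0
          · simp [hk]
          · simp [huniq hx hi hk hi0]
        · exact absurd hx (hs k)
  · left
    push Not at hz
    have hr : ∀ {k}, r k ∈ S → k = 0 := fun {k} hk => by
      by_contra h
      exact hz k h hk
    obtain ⟨x, hx, hx1⟩ := S.bot_or_exists_ne_one.resolve_left hS
    rcases x with k | j
    · exact absurd (by rw [hr hx, r_zero]) hx1
    · rw [show (S : Set (DihedralGroup n)) = {r 0, sr j} from ?_, Set.ncard_pair]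
      · simp [-r_zero]
      · ext x
        simp only [SetLike.mem_coe, Set.mem_insert_iff, Set.mem_singleton_iff]
        refine ⟨fun hy => ?_, by rintro (rfl | rfl) <;> assumption⟩
        rcases x with k | k
        · simp [hr hy]
        · simp [sub_eq_zero.1 (hr (hss hx hy))]

theorem exists_zpow_of_r_mem {S : Subgroup (DihedralGroup n)} {i j : ZMod n} (hi : r i ∈ S)
    (hj : r j ∈ S) : ∃ w ∈ S, ∃ p q : ℤ, r i = w ^ p ∧ r j = w ^ q := by
  obtain ⟨a, rfl⟩ := ZMod.intCast_surjective i
  obtain ⟨b, rfl⟩ := ZMod.intCast_surjective j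
  simp only [← r_one_zpow] at hi hj ⊢
  obtain ⟨p, hp⟩ := Int.gcd_dvd_left a b
  obtain ⟨q, hq⟩ := Int.gcd_dvd_right a b
  refine ⟨r 1 ^ (Int.gcd a b : ℤ), ?_, p, q, ?_, ?_⟩
  · rw [Int.gcd_eq_gcd_ab, zpow_add, zpow_mul, zpow_mul]
    exact S.mul_mem (S.zpow_mem hi _) (S.zpow_mem hj _)
  · rw [← zpow_mul, ← hp]
  · rw [← zpow_mul, ← hq]

/-- If a subgroup of a dihedral group contains the squares of elements of `S` and a reflection
lying in `S`, it has index at most two in `S`. -/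
theorem mem_or_mem_or_mul_mem {S K : Subgroup (DihedralGroup n)} (hKS : K ≤ S)
    (hsq : ∀ x ∈ S, x * x ∈ K) {t : ZMod n} (ht : sr t ∈ K) {u v : DihedralGroup n}
    (hu : u ∈ S) (hv : v ∈ S) : u ∈ K ∨ v ∈ K ∨ u * v ∈ K := by
  obtain ⟨p, hp, i, hi⟩ : ∃ p ∈ K, ∃ i, p * u = r i := by
    rcases u with i | i
    · exact ⟨1, K.one_mem, i, one_mul _⟩
    · exact ⟨sr t, ht, _, sr_mul_sr _ _⟩
  obtain ⟨q, hq, j, hj⟩ : ∃ q ∈ K, ∃ j, v * q = r j := by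
    rcases v with i | i
    · exact ⟨1, K.one_mem, i, mul_one _⟩
    · exact ⟨sr t, ht, _, sr_mul_sr _ _⟩
  obtain ⟨w, hw, k, l, hk, hl⟩ := exists_zpow_of_r_mem
    (hi ▸ S.mul_mem (hKS hp) hu) (hj ▸ S.mul_mem hv (hKS hq))
  have heven : ∀ {m : ℤ}, Even m → w ^ m ∈ K := by
    rintro _ ⟨m, rfl⟩
    rw [← two_mul, zpow_mul, zpow_two]
    exact K.zpow_mem (hsq w hw) m
  rw [← K.mul_mem_cancel_left (x := p) (y := u) hp, ← K.mul_mem_cancel_right (y := v) (x := q) hq,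
    ← K.mul_mem_cancel_left (x := p) (y := u * v) hp,
    ← K.mul_mem_cancel_right (y := p * (u * v)) (x := q) hq,
    show p * (u * v) * q = p * u * (v * q) by group, hi, hj, hk, hl, ← zpow_add]
  rcases Int.even_or_odd k with h | h
  · exact .inl (heven h)
  · rcases Int.even_or_odd l with h' | h'
    · exact .inr (.inl (heven h'))
    · exact .inr (.inr (heven (h.add_odd h')))

theorem isRotaBaxter_disjoint_of_sr (hB : IsRotaBaxter B) {t : ZMod n}
    (hx : (1, sr t) ∈ hB.graph) (hx' : sr t ∈ Set.range B) {y : DihedralGroup n}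
    (hy : (y, 1) ∈ hB.graph) (hy' : y ∈ Set.range (tilde B)) : y = 1 := by
  by_contra hy1
  obtain ⟨c, hc⟩ := hB.mem_range_iff.1 hx'
  obtain ⟨d, hd⟩ := hB.mem_range_tilde_iff.1 hy'
  have hxy := hB.graph.mul_mem hc hy
  have hyK : ∀ {z}, (1, z) ∈ hB.graph → (z, 1) ∈ hB.graph → z = 1 := fun h1 h2 =>
    hB.eq_one_of_diag_mem (by simpa using hB.graph.mul_mem h1 h2)
  have hmem := mem_or_mem_or_mul_mem
    (S := hB.graph.map (MonoidHom.snd (DihedralGroup n) (DihedralGroup n)))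
    (K := hB.graph.comap (MonoidHom.inr (DihedralGroup n) (DihedralGroup n)))
    (fun k hk => ⟨_, hk, rfl⟩)
    (by rintro _ ⟨⟨a, b⟩, hab, rfl⟩; exact isRotaBaxter_sq_mem_graph' hB hab)
    (t := t) hx (u := c) (v := sr t * y) ⟨_, hc, rfl⟩ ⟨_, hB.graph.mul_mem hx hd, rfl⟩
  simp only [Subgroup.mem_comap, MonoidHom.inr_apply] at hmem
  rcases hmem with h | h | h
  · have := hyK hx (by simpa using hB.graph.mul_mem hc (hB.graph.inv_mem h))
    simp [one_def, -r_zero] at this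
  · exact hy1 (hyK (by simpa [← mul_assoc] using hB.graph.mul_mem hx h) hy)
  · have hcc := isRotaBaxter_sq_mem_graph' hB hc
    have h1 := hB.eq_one_of_diag_mem (x := sr t * y) (by
      convert hB.graph.mul_mem (hB.graph.inv_mem hcc) (hB.graph.mul_mem hxy h) using 1
      simp only [Prod.inv_mk, Prod.mk_mul_mk]
      congr 1 <;> group)
    rw [mul_eq_one_iff_inv_eq, inv_sr] at h1
    exact hy1 (hyK (h1 ▸ hx) hy)

/-- One of `ker B ∩ Im B` and `ker B̃ ∩ Im B̃` is trivial. -/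
theorem isRotaBaxter_disjoint [NeZero n] (hB : IsRotaBaxter B) :
    (∀ g, B g = 1 → g ∈ Set.range B → g = 1) ∨
      ∀ g, tilde B g = 1 → g ∈ Set.range (tilde B) → g = 1 := by
  by_contra! h
  obtain ⟨⟨x, hx, hxr, hx1⟩, y, hy, hyr, hy1⟩ := h
  rw [← hB.one_mem_graph_iff] at hx
  rw [← hB.tilde_isRotaBaxter.one_mem_graph_iff, hB.mem_graph_tilde] at hy
  rcases x with i | i
  · rcases y with j | j
    · have hself : ∀ {k : ZMod n}, r k ∈ Set.range B → r k ∈ Set.range (tilde B) →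
          k + k = 0 := fun {k} h₁ h₂ => by
        have := isRotaBaxter_mul_self_of_mem_rangeInf hB (x := r k)
          (by rw [← SetLike.mem_coe, hB.coe_rangeInf]; exact ⟨h₁, h₂⟩)
        rw [r_mul_r, one_def] at this
        injection this
      have hij : i = j := eq_of_add_self_eq_zero
        (hself hxr (hB.mem_range_tilde_iff.2 ⟨_, hx⟩))
        (hself (hB.mem_range_iff.2 ⟨_, hy⟩) hyr)
        (by rintro rfl; exact hx1 r_zero) (by rintro rfl; exact hy1 r_zero)
      subst hij
      exact hx1 (hB.eq_one_of_diag_mem (by simpa [-r_mul_r] using hB.graph.mul_mem hx hy))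
    · exact hx1 (isRotaBaxter_disjoint_of_sr hB.tilde_isRotaBaxter (t := j)
        (hB.mem_graph_tilde.2 hy) hyr (hB.mem_graph_tilde.2 hx)
        (by rwa [IsRotaBaxter.tilde_tilde]))
  · exact hy1 (isRotaBaxter_disjoint_of_sr hB hx hxr hy hyr)

end DihedralGroup

/-- For n even, any non-splitting Rota–Baxter operator B on D₂ₙ: one of C ∈ {B, B̃} gives an
exact factorization D₂ₙ = ker(C)·Im(C), C̃ is multiplicative on Im(C) with image
R = Im(B) ∩ Im(B̃), and R has 2 or 4 elements, all of exponent 2. -/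
theorem stmt2 (n : ℕ) (hn : 2 ≤ n) (heven : Even n)
    (B : DihedralGroup n → DihedralGroup n) (hB : IsRotaBaxter B)
    (hns : ¬ IsSplitting B) :
    ∃ C : DihedralGroup n → DihedralGroup n, (C = B ∨ C = tilde B) ∧
      (∀ g : DihedralGroup n, C g = 1 → g ∈ Set.range C → g = 1) ∧
      (∀ g : DihedralGroup n, ∃ k, C k = 1 ∧ ∃ l ∈ Set.range C, g = k * l) ∧
      (∀ x ∈ Set.range C, ∀ y ∈ Set.range C, tilde C (x * y) = tilde C x * tilde C y) ∧
      tilde C '' Set.range C = Set.range B ∩ Set.range (tilde B) ∧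
      ((Set.range B ∩ Set.range (tilde B)).ncard = 2 ∨
        (Set.range B ∩ Set.range (tilde B)).ncard = 4) ∧
      (∀ x ∈ Set.range B ∩ Set.range (tilde B), x * x = 1) := by
  have : NeZero n := ⟨by omega⟩
  have hne : hB.rangeInf ≠ ⊥ := fun h => hns (hB.isSplitting_of_rangeInf_eq_bot h)
  have hcard := DihedralGroup.ncard_of_mul_self hB.rangeInf hne
    fun x hx => DihedralGroup.isRotaBaxter_mul_self_of_mem_rangeInf hB hx
  rw [hB.coe_rangeInf] at hcard
  have hexp : ∀ x ∈ Set.range B ∩ Set.range (tilde B), x * x = 1 := fun x hx =>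
    DihedralGroup.isRotaBaxter_mul_self_of_mem_rangeInf hB
      (by rwa [← SetLike.mem_coe, hB.coe_rangeInf])
  rcases DihedralGroup.isRotaBaxter_disjoint hB with h | h
  · exact ⟨B, .inl rfl, h, hB.exists_ker_mul_range h,
      fun x hx y hy => hB.tilde_mul_of_sq
        (fun _ _ => DihedralGroup.isRotaBaxter_sq_mem_graph hB) hx hy,
      hB.tilde_image_range, hcard, hexp⟩
  · have hB' := hB.tilde_isRotaBaxter
    refine ⟨tilde B, .inr rfl, h, hB'.exists_ker_mul_range h,
      fun x hx y hy => hB'.tilde_mul_of_sq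
        (fun _ _ => DihedralGroup.isRotaBaxter_sq_mem_graph hB') hx hy,
      ?_, hcard, hexp⟩
    rw [hB'.tilde_image_range, IsRotaBaxter.tilde_tilde, Set.inter_comm]
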